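/- arXiv:0704.3693 — 2 statements merged into one kernel-verified Lean document; each statement's English description precedes it below -/
import Mathlib

section
/- Let τ be the ℂ-algebra automorphism of ℂ[x,y] swapping the variables x and y. Then τ(R) = R′ and τ(S_{i_p}) = S′_{i′_{n+1−p}} for all 0 ≤ p ≤ n; consequently τ induces a ring isomorphism End_R(S_{i₀} ⊕ ⋯ ⊕ S_{iₙ}) ≅ End_{R′}(S′_{i′₀} ⊕ ⋯ ⊕ S′_{i′ₙ}). (The reconstruction algebra associated to [α₁,…,αₙ] is the same as that associated to [αₙ,…,α₁].) -/
open MvPolynomial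

/-- The two-step linear recursion `s₀ = x0`, `s₁ = x1`, `s_{t+1} = α_t s_t − s_{t−1}`;
with `x0 = r, x1 = a` this is the i-series and with `x0 = 0, x1 = 1` the j-series. -/
def ser (x0 x1 : ℤ) (α : ℕ → ℕ) : ℕ → ℤ
  | 0 => x0
  | 1 => x1
  | t + 2 => (α (t + 1) : ℤ) * ser x0 x1 α (t + 1) - ser x0 x1 α t

/-- Hirzebruch–Jung (negative) continued fraction value of a list. -/
def hj : List ℚ → ℚ
  | [] => 0
  | q :: L => q - 1 / hj L

/-- The invariant subalgebra `R = {p ∈ ℂ[x,y] | g p = p}`. -/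
noncomputable def fixedSub (g : MvPolynomial (Fin 2) ℂ ≃ₐ[ℂ] MvPolynomial (Fin 2) ℂ) :
    Subalgebra ℂ (MvPolynomial (Fin 2) ℂ) :=
  AlgHom.equalizer g.toAlgHom (AlgHom.id ℂ _)

/-- The `R`-submodule `S_c = {f ∈ ℂ[x,y] | g f = c·f}` (eigenspace of the group action),
where `R = fixedSub g` is the invariant ring.  For `c = ε^t` this is the module `S_t`. -/
noncomputable def eigenSub (g : MvPolynomial (Fin 2) ℂ ≃ₐ[ℂ] MvPolynomial (Fin 2) ℂ)
    (c : ℂ) : Submodule (fixedSub g) (MvPolynomial (Fin 2) ℂ) where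
  carrier := {f | g f = C c * f}
  add_mem' := by
    intro f₁ f₂ h1 h2
    simp only [Set.mem_setOf_eq] at *
    rw [map_add, h1, h2, mul_add]
  zero_mem' := by simp
  smul_mem' := by
    intro s f hf
    simp only [Set.mem_setOf_eq] at *
    rw [Algebra.smul_def, map_mul, hf]
    have hs : g (algebraMap (fixedSub g) (MvPolynomial (Fin 2) ℂ) s) =
        algebraMap (fixedSub g) (MvPolynomial (Fin 2) ℂ) s := s.2
    rw [hs]
    ring

section ShortcutInstances

variable (g : MvPolynomial (Fin 2) ℂ ≃ₐ[ℂ] MvPolynomial (Fin 2) ℂ)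

set_option synthInstance.maxHeartbeats 1000000
set_option maxHeartbeats 4000000

/-- shortcut instance (for performance only) -/
noncomputable instance fixedSub.instCommRing : CommRing (fixedSub g) :=
  Subalgebra.toCommRing _

/-- shortcut instance (for performance only) -/
noncomputable instance eigenSub.instAddCommGroup (c : ℂ) : AddCommGroup (eigenSub g c) :=
  inferInstance

/-- shortcut instance (for performance only) -/
noncomputable instance eigenSub.instModule (c : ℂ) :
    Module (fixedSub g) (eigenSub g c) := inferInstance

/-- shortcut instance (for performance only) -/
noncomputable instance eigenSub.instEndAlgebra (n : ℕ) (c : Fin (n + 1) → ℂ) :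
    Algebra (fixedSub g) (Module.End (fixedSub g) ((p : Fin (n + 1)) → eigenSub g (c p))) :=
  inferInstance

end ShortcutInstances

/-- Dropping the first term of the recursion shifts the coefficients. -/
lemma ser_succ (x0 x1 : ℤ) (α : ℕ → ℕ) (t : ℕ) :
    ser x0 x1 α (t + 1) = ser x1 (α 1 * x1 - x0) (fun s => α (s + 1)) t := by
  induction t using Nat.twoStepInduction with
  | zero => rfl
  | one => rfl
  | more t ih0 ih1 => rw [ser, ih1, ih0, ser]

lemma hj_range_succ (α : ℕ → ℕ) (m : ℕ) :
    hj ((List.range (m + 1)).map fun t => (α (t + 1) : ℚ)) =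
      α 1 - 1 / hj ((List.range m).map fun t => (α (t + 1 + 1) : ℚ)) := by
  rw [List.range_succ_eq_map, List.map_cons, List.map_map, hj]
  rfl

lemma one_lt_hj (m : ℕ) (α : ℕ → ℕ) (hα : ∀ t, 1 ≤ t → t ≤ m + 1 → 2 ≤ α t) :
    1 < hj ((List.range (m + 1)).map fun t => (α (t + 1) : ℚ)) := by
  induction m generalizing α with
  | zero =>
    have h : (2 : ℚ) ≤ α 1 := by exact_mod_cast hα 1 le_rfl le_rfl
    rw [hj_range_succ]
    simp only [List.range_zero, List.map_nil, hj, div_zero, sub_zero]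
    linarith
  | succ m ih =>
    have h : (2 : ℚ) ≤ α 1 := by exact_mod_cast hα 1 le_rfl (by omega)
    have ih' := ih (fun s => α (s + 1)) fun t _ ht => hα (t + 1) (by omega) (by omega)
    rw [hj_range_succ]
    have := (div_lt_one (by linarith)).2 ih'
    linarith

/-- The i-series of a continued fraction expansion is positive and terminates at `0`. -/
lemma ser_of_hj (m : ℕ) (α : ℕ → ℕ) (hα : ∀ t, 1 ≤ t → t ≤ m + 1 → 2 ≤ α t) (x0 x1 : ℤ)
    (h1 : 0 < x1)
    (h : hj ((List.range (m + 1)).map fun t => (α (t + 1) : ℚ)) = (x0 : ℚ) / x1) :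
    ser x0 x1 α (m + 2) = 0 ∧ ∀ t, t ≤ m + 1 → 0 < ser x0 x1 α t := by
  have h1' : (0 : ℚ) < x1 := by exact_mod_cast h1
  have h0 : 0 < x0 := by
    have hlt := one_lt_hj m α hα
    rw [h, one_lt_div h1'] at hlt
    exact_mod_cast h1'.trans hlt
  induction m generalizing α x0 x1 with
  | zero =>
    rw [hj_range_succ] at h
    simp only [List.range_zero, List.map_nil, hj, div_zero, sub_zero] at h
    rw [eq_div_iff h1'.ne'] at h
    constructor
    · simp only [ser]
      have : (α 1 : ℤ) * x1 = x0 := by exact_mod_cast h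
      simp [this]
    · intro t ht
      interval_cases t
      · exact h0
      · exact h1
  | succ m ih =>
    have hα' : ∀ t, 1 ≤ t → t ≤ m + 1 → 2 ≤ α (t + 1) :=
      fun t _ ht => hα (t + 1) (by omega) (by omega)
    have hlt := one_lt_hj m (fun s => α (s + 1)) hα'
    rw [hj_range_succ] at h
    set H := hj ((List.range (m + 1)).map fun t => (α (t + 1 + 1) : ℚ))
    have hH : 0 < H := by linarith
    have hx : ((α 1 * x1 - x0 : ℤ) : ℚ) = x1 / H := by
      push_cast
      field_simp at h ⊢
      linarith
    have hx2 : 0 < α 1 * x1 - x0 := by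
      have : (0 : ℚ) < x1 / H := by positivity
      rw [← hx] at this
      exact_mod_cast this
    have hv : H = (x1 : ℚ) / (α 1 * x1 - x0 : ℤ) := by
      rw [hx]
      field_simp
    obtain ⟨e, pos⟩ := ih (fun s => α (s + 1)) hα' x1 (α 1 * x1 - x0) hx2 hv
      (by exact_mod_cast hx2) h1
    refine ⟨by rw [ser_succ, e], fun t ht => ?_⟩
    cases t with
    | zero => exact h0
    | succ t =>
      rw [ser_succ]
      exact pos t (by omega)

lemma isCoprime_ser (x0 x1 : ℤ) (α : ℕ → ℕ) (h : IsCoprime x0 x1) (t : ℕ) :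
    IsCoprime (ser x0 x1 α t) (ser x0 x1 α (t + 1)) := by
  induction t with
  | zero => exact h
  | succ t ih =>
    obtain ⟨u, v, e⟩ := ih
    exact ⟨v + u * α (t + 1), -u, by rw [ser, ← e]; ring⟩

/-- The Wronskian of the i-series and the j-series is constant. -/
lemma ser_wronskian (x0 x1 : ℤ) (α : ℕ → ℕ) (t : ℕ) :
    ser x0 x1 α t * ser 0 1 α (t + 1) - ser x0 x1 α (t + 1) * ser 0 1 α t = x0 := by
  induction t with
  | zero => simp [ser]
  | succ t ih =>
    simp only [ser]
    linarith

lemma ser_modEq (x0 x1 : ℤ) (α : ℕ → ℕ) (t : ℕ) :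
    ser x0 x1 α t ≡ x1 * ser 0 1 α t [ZMOD x0] := by
  induction t using Nat.twoStepInduction with
  | zero => simp [ser, Int.ModEq]
  | one => simp [ser]
  | more t ih0 ih1 =>
    simp only [ser]
    convert (ih1.mul_left (α (t + 1))).sub ih0 using 1
    ring

/-- Reading a series backwards solves the recursion with reversed coefficients. -/
lemma ser_reverse (n : ℕ) (α : ℕ → ℕ) (x0 x1 : ℤ)
    (h : ser x0 x1 (fun t => α (n + 1 - t)) (n + 1) = 0) (p : ℕ) (hp : p ≤ n + 1) :
    ser x0 x1 (fun t => α (n + 1 - t)) (n + 1 - p) =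
      ser x0 x1 (fun t => α (n + 1 - t)) n * ser 0 1 α p := by
  induction p using Nat.twoStepInduction with
  | zero => simp [ser, h]
  | one => simp [ser]
  | more p ih0 ih1 =>
    obtain ⟨q, rfl⟩ : ∃ q, n = p + 1 + q := ⟨n - (p + 1), by omega⟩
    have e0 := ih0 (by omega)
    have e1 := ih1 (by omega)
    rw [show p + 1 + q + 1 - p = q + 2 by omega, ser,
      show p + 1 + q + 1 - (q + 1) = p + 1 by omega] at e0
    rw [show p + 1 + q + 1 - (p + 1) = q + 1 by omega] at e1
    rw [show p + 1 + q + 1 - (p + 2) = q by omega, ser]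
    linear_combination (α (p + 1) : ℤ) * e1 - e0

/-- Comparison of the i-series of a continued fraction and of the reversed one. -/
lemma ser_reverse_modEq (r a n : ℕ) (α : ℕ → ℕ) (ha : 1 ≤ a) (har : a < r)
    (hcop : Nat.Coprime r a) (hn : 1 ≤ n) (hα : ∀ t, 1 ≤ t → t ≤ n → 2 ≤ α t)
    (hval : hj ((List.range n).map fun t => (α (t + 1) : ℚ)) = (r : ℚ) / (a : ℚ))
    (b : ℕ) (hb1 : 1 ≤ b)
    (hvalb : hj ((List.range n).map fun t => (α (n - t) : ℚ)) = (r : ℚ) / (b : ℚ)) :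
    (a * b ≡ 1 [MOD r]) ∧
      ∀ p, p ≤ n + 1 → (ser r a α p).toNat ≡
        a * (ser r b (fun t => α (n + 1 - t)) (n + 1 - p)).toNat [MOD r] := by
  obtain ⟨m, rfl⟩ : ∃ m, n = m + 1 := ⟨n - 1, by omega⟩
  obtain ⟨hi0, hipos⟩ := ser_of_hj m α hα r a (by exact_mod_cast ha)
    (by simpa only [Int.cast_natCast] using hval)
  obtain ⟨hk0, hkpos⟩ := ser_of_hj m (fun t => α (m + 1 + 1 - t))
    (fun t h1 h2 => hα _ (by omega) (by omega)) r b (by exact_mod_cast hb1)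
    (by simpa only [Nat.add_sub_add_right, Int.cast_natCast] using hvalb)
  have hin : ser r a α (m + 1) = 1 := by
    have h := isCoprime_ser r a α (by exact_mod_cast hcop.isCoprime) (m + 1)
    rw [hi0, isCoprime_zero_right, Int.isUnit_iff] at h
    have := hipos (m + 1) le_rfl
    omega
  have hjn : ser 0 1 α (m + 2) = r := by
    have h := ser_wronskian r a α (m + 1)
    rw [hi0, hin] at h
    linarith
  have hrev := ser_reverse (m + 1) α r b hk0
  have hd : ser r b (fun t => α (m + 1 + 1 - t)) (m + 1) = 1 := by
    have h := hrev (m + 2) le_rfl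
    rw [hjn, Nat.sub_self, ser] at h
    have hr : (r : ℤ) ≠ 0 := by omega
    exact (mul_right_cancel₀ hr (by linarith)).symm
  simp only [hd, one_mul] at hrev
  have hmod : ∀ p, p ≤ m + 2 → ser r a α p ≡
      a * ser r b (fun t => α (m + 1 + 1 - t)) (m + 1 + 1 - p) [ZMOD r] := by
    intro p hp
    rw [hrev p hp]
    exact ser_modEq r a α p
  refine ⟨?_, fun p hp => ?_⟩
  · have h := hmod (m + 1) (by omega)
    rw [hin, show m + 1 + 1 - (m + 1) = 1 by omega, ser] at h
    rw [← Int.natCast_modEq_iff]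
    exact_mod_cast h.symm
  · have hnn : 0 ≤ ser r a α p := by
      rcases hp.lt_or_eq with h | rfl
      · exact (hipos p (by omega)).le
      · exact hi0.ge
    have hnn' : 0 ≤ ser r b (fun t => α (m + 1 + 1 - t)) (m + 1 + 1 - p) := by
      rcases p.eq_zero_or_pos with rfl | h
      · exact hk0.ge
      · exact (hkpos _ (by omega)).le
    rw [← Int.natCast_modEq_iff]
    push_cast
    rw [Int.toNat_of_nonneg hnn, Int.toNat_of_nonneg hnn']
    exact hmod p hp

lemma IsPrimitiveRoot.pow_eq_pow_of_modEq {r s t : ℕ} {ε : ℂ} (hε : IsPrimitiveRoot ε r)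
    (h : s ≡ t [MOD r]) : ε ^ s = ε ^ t := by
  rw [pow_eq_pow_mod s hε.pow_eq_one, pow_eq_pow_mod t hε.pow_eq_one, h]

lemma algEquiv_pow_apply {σ : Type*} (g : MvPolynomial σ ℂ ≃ₐ[ℂ] MvPolynomial σ ℂ) (c : ℂ)
    (f : MvPolynomial σ ℂ) (h : g f = C c * f) (k : ℕ) : (g ^ k) f = C (c ^ k) * f := by
  induction k with
  | zero => simp
  | succ k ih =>
    have hC : (g ^ k) (C c) = C c := (g ^ k).commutes c
    rw [pow_succ, AlgEquiv.mul_apply, h, map_mul, hC, ih, pow_succ, map_mul]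
    ring

/-- The variable swap carries eigenvectors of `(1/r)(1,a)` to eigenvectors of `(1/r)(1,b)`
when `ab ≡ 1` modulo `r`. -/
lemma swap_eigen {r a b : ℕ} {ε : ℂ} (hε : IsPrimitiveRoot ε r) (hab : a * b ≡ 1 [MOD r])
    {g g' : MvPolynomial (Fin 2) ℂ ≃ₐ[ℂ] MvPolynomial (Fin 2) ℂ}
    (hgx : g (X 0) = C ε * X 0) (hgy : g (X 1) = C (ε ^ a) * X 1)
    (hg'x : g' (X 0) = C ε * X 0) (hg'y : g' (X 1) = C (ε ^ b) * X 1)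
    {c : ℂ} {f : MvPolynomial (Fin 2) ℂ} (hf : g f = C c * f) :
    g' (renameEquiv ℂ (Equiv.swap (0 : Fin 2) 1) f) =
      C (c ^ b) * renameEquiv ℂ (Equiv.swap (0 : Fin 2) 1) f := by
  have key : g'.toAlgHom.comp (renameEquiv ℂ (Equiv.swap (0 : Fin 2) 1)).toAlgHom =
      (renameEquiv ℂ (Equiv.swap (0 : Fin 2) 1)).toAlgHom.comp (g ^ b).toAlgHom := by
    refine MvPolynomial.algHom_ext fun i => ?_
    fin_cases i
    · have h := algEquiv_pow_apply g _ _ hgx b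
      change g' (rename _ (X 0)) = rename _ ((g ^ b) (X 0))
      rw [h]
      simp [hg'y]
    · have h := algEquiv_pow_apply g _ _ hgy b
      rw [← pow_mul, hε.pow_eq_pow_of_modEq hab, pow_one] at h
      change g' (rename _ (X 1)) = rename _ ((g ^ b) (X 1))
      rw [h]
      simp [hg'x]
  calc g' (renameEquiv ℂ (Equiv.swap (0 : Fin 2) 1) f)
      = renameEquiv ℂ (Equiv.swap (0 : Fin 2) 1) ((g ^ b) f) := DFunLike.congr_fun key f
    _ = C (c ^ b) * renameEquiv ℂ (Equiv.swap (0 : Fin 2) 1) f := by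
      rw [algEquiv_pow_apply g c f hf b, map_mul]
      simp

lemma swap_swap_apply (f : MvPolynomial (Fin 2) ℂ) :
    renameEquiv ℂ (Equiv.swap (0 : Fin 2) 1) (renameEquiv ℂ (Equiv.swap (0 : Fin 2) 1) f) = f := by
  simp [rename_rename, ← Equiv.coe_trans]

/-- Conjugation by a semilinear bijection identifies endomorphism rings. -/
def endRingEquivOfSemilinear {R R' M M' : Type*} [Semiring R] [Semiring R'] [AddCommMonoid M]
    [AddCommMonoid M'] [Module R M] [Module R' M'] (σ : R ≃ R') (e : M ≃+ M')
    (he : ∀ (s : R) (m : M), e (s • m) = σ s • e m) :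
    Module.End R M ≃+* Module.End R' M' where
  toFun φ :=
    { toFun := fun m => e (φ (e.symm m))
      map_add' := by simp
      map_smul' := fun s m => by
        obtain ⟨s, rfl⟩ := σ.surjective s
        obtain ⟨m, rfl⟩ := e.surjective m
        simp [← he] }
  invFun ψ :=
    { toFun := fun m => e.symm (ψ (e m))
      map_add' := by simp
      map_smul' := fun s m => by
        rw [he, map_smul, RingHom.id_apply, AddEquiv.symm_apply_eq, he, AddEquiv.apply_symm_apply] }
  left_inv φ := by ext; simp
  right_inv ψ := by ext; simp
  map_mul' φ ψ := by ext; simp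
  map_add' φ ψ := by ext; simp

/-- An involution of the polynomial ring exchanging invariants and, up to an involution of the
index set, eigenspaces, identifies the endomorphism rings of the products of eigenspaces. -/
lemma nonempty_end_ringEquiv {n : ℕ}
    (g g' τ : MvPolynomial (Fin 2) ℂ ≃ₐ[ℂ] MvPolynomial (Fin 2) ℂ) (hτ : ∀ f, τ (τ f) = f)
    (h : ∀ f, g f = f → g' (τ f) = τ f) (h' : ∀ f, g' f = f → g (τ f) = τ f)
    (c c' : Fin (n + 1) → ℂ) (ρ : Fin (n + 1) → Fin (n + 1)) (hρ : ∀ p, ρ (ρ p) = p)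
    (hc : ∀ p f, g f = C (c (ρ p)) * f → g' (τ f) = C (c' p) * τ f)
    (hc' : ∀ p f, g' f = C (c' (ρ p)) * f → g (τ f) = C (c p) * τ f) :
    Nonempty (Module.End (fixedSub g) ((p : Fin (n + 1)) → eigenSub g (c p)) ≃+*
      Module.End (fixedSub g') ((p : Fin (n + 1)) → eigenSub g' (c' p))) := by
  let σ : fixedSub g ≃ fixedSub g' :=
    { toFun := fun s => ⟨τ s.1, h s.1 s.2⟩
      invFun := fun s => ⟨τ s.1, h' s.1 s.2⟩
      left_inv := fun s => Subtype.ext (hτ s.1)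
      right_inv := fun s => Subtype.ext (hτ s.1) }
  let e : ((p : Fin (n + 1)) → eigenSub g (c p)) ≃+ ((p : Fin (n + 1)) → eigenSub g' (c' p)) :=
    { toFun := fun v p => ⟨τ (v (ρ p)).1, hc p _ (v (ρ p)).2⟩
      invFun := fun v p => ⟨τ (v (ρ p)).1, hc' p _ (v (ρ p)).2⟩
      left_inv := fun v => funext fun p => Subtype.ext ((hτ _).trans (by rw [hρ]))
      right_inv := fun v => funext fun p => Subtype.ext ((hτ _).trans (by rw [hρ]))
      map_add' := fun v w => funext fun p => Subtype.ext (map_add τ _ _) }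
  exact ⟨endRingEquivOfSemilinear σ e fun s v => funext fun p => Subtype.ext (map_mul τ _ _)⟩

set_option synthInstance.maxHeartbeats 1000000 in
set_option maxHeartbeats 8000000 in
/-- the variable swap `τ : x ↔ y` carries the invariant ring `R` of
`(1/r)(1,a)` to the invariant ring `R′` of `(1/r)(1,b)` and the special CM module
`S_{i_p}` to `S′_{i′_{n+1−p}}`; consequently the endomorphism rings of the sums of the
special CM modules are isomorphic (the reconstruction algebra associated to
`[α₁,…,αₙ]` is the same as that associated to `[αₙ,…,α₁]`). -/
theorem stmt_16 (r a n : ℕ) (α : ℕ → ℕ)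
    (ha : 1 ≤ a) (har : a < r) (hcop : Nat.Coprime r a) (hn : 1 ≤ n)
    (hα : ∀ t, 1 ≤ t → t ≤ n → 2 ≤ α t)
    (hval : hj ((List.range n).map fun t => (α (t + 1) : ℚ)) = (r : ℚ) / (a : ℚ))
    -- b : the integer with 1 ≤ b < r whose HJ expansion of r/b is [αₙ, …, α₁]
    (b : ℕ) (hb1 : 1 ≤ b) (hbr : b < r)
    (hvalb : hj ((List.range n).map fun t => (α (n - t) : ℚ)) = (r : ℚ) / (b : ℚ))
    (ε : ℂ) (hε : IsPrimitiveRoot ε r)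
    (g : MvPolynomial (Fin 2) ℂ ≃ₐ[ℂ] MvPolynomial (Fin 2) ℂ)
    (hgx : g (X 0) = C ε * X 0) (hgy : g (X 1) = C (ε ^ a) * X 1)
    (g' : MvPolynomial (Fin 2) ℂ ≃ₐ[ℂ] MvPolynomial (Fin 2) ℂ)
    (hg'x : g' (X 0) = C ε * X 0) (hg'y : g' (X 1) = C (ε ^ b) * X 1) :
    (⇑(renameEquiv ℂ (Equiv.swap (0 : Fin 2) 1)) ''
        {p : MvPolynomial (Fin 2) ℂ | g p = p} =
      {p : MvPolynomial (Fin 2) ℂ | g' p = p}) ∧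
    (∀ p, p ≤ n →
      ⇑(renameEquiv ℂ (Equiv.swap (0 : Fin 2) 1)) ''
          {f : MvPolynomial (Fin 2) ℂ | g f = C (ε ^ (ser r a α p).toNat) * f} =
        {f : MvPolynomial (Fin 2) ℂ |
          g' f = C (ε ^ (ser r b (fun t => α (n + 1 - t)) (n + 1 - p)).toNat) * f}) ∧
    Nonempty
      ((Module.End (fixedSub g)
          ((p : Fin (n + 1)) → eigenSub g (ε ^ (ser r a α p.1).toNat))) ≃+*
        (Module.End (fixedSub g')
          ((p : Fin (n + 1)) →
            eigenSub g' (ε ^ (ser r b (fun t => α (n + 1 - t)) p.1).toNat)))) := by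
  obtain ⟨hab, hmod⟩ :=
    ser_reverse_modEq r a n α ha har hcop hn hα hval b hb1 hvalb
  have hba : b * a ≡ 1 [MOD r] := by rwa [mul_comm]
  have fwd {c : ℂ} {f : MvPolynomial (Fin 2) ℂ} (hf : g f = C c * f) :=
    swap_eigen hε hab hgx hgy hg'x hg'y hf
  have bwd {c : ℂ} {f : MvPolynomial (Fin 2) ℂ} (hf : g' f = C c * f) :=
    swap_eigen hε hba hg'x hg'y hgx hgy hf
  have hbwd : ∀ p, p ≤ n + 1 →
      (ε ^ (ser r b (fun t => α (n + 1 - t)) (n + 1 - p)).toNat) ^ a =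
        ε ^ (ser r a α p).toNat := by
    intro p hp
    rw [← pow_mul, mul_comm]
    exact hε.pow_eq_pow_of_modEq (hmod p hp).symm
  have hfwd : ∀ p, p ≤ n + 1 → (ε ^ (ser r a α p).toNat) ^ b =
      ε ^ (ser r b (fun t => α (n + 1 - t)) (n + 1 - p)).toNat := by
    intro p hp
    rw [← hbwd p hp, ← pow_mul, ← pow_mul]
    refine hε.pow_eq_pow_of_modEq ?_
    simpa [mul_assoc] using hab.mul_left (ser r b (fun t => α (n + 1 - t)) (n + 1 - p)).toNat
  have inv : ∀ f, g f = f → g' (renameEquiv ℂ (Equiv.swap (0 : Fin 2) 1) f) =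
      renameEquiv ℂ (Equiv.swap (0 : Fin 2) 1) f := by
    intro f hf
    simpa using fwd (c := 1) (f := f) (by simpa using hf)
  have inv' : ∀ f, g' f = f → g (renameEquiv ℂ (Equiv.swap (0 : Fin 2) 1) f) =
      renameEquiv ℂ (Equiv.swap (0 : Fin 2) 1) f := by
    intro f hf
    simpa using bwd (c := 1) (f := f) (by simpa using hf)
  refine ⟨?_, fun p hp => ?_, ?_⟩
  · refine Set.Subset.antisymm (Set.image_subset_iff.2 inv) fun f hf => ?_
    exact ⟨_, inv' f hf, swap_swap_apply f⟩
  · refine Set.Subset.antisymm (Set.image_subset_iff.2 fun f hf => ?_) fun f hf => ?_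
    · have := fwd hf
      rwa [hfwd p (by omega)] at this
    · refine ⟨_, ?_, swap_swap_apply f⟩
      have := bwd hf
      rwa [hbwd p (by omega)] at this
  · -- the modules indexed by `0` and `n + 1` are both the invariant ring
    have hr : ε ^ (r : ℤ).toNat = 1 := by simpa using hε.pow_eq_one
    let ρ : Fin (n + 1) → Fin (n + 1) :=
      fun p => if h : p.1 = 0 then p else ⟨n + 1 - p.1, by omega⟩
    have hρ : ∀ p, ρ (ρ p) = p := by
      intro p
      by_cases h : p.1 = 0
      · simp only [ρ, h, dite_true]
      · have : n + 1 - p.1 ≠ 0 := by omega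
        ext
        simp only [ρ, h, this, dite_false]
        omega
    have hcρ : ∀ p : Fin (n + 1), (ε ^ (ser r a α (ρ p).1).toNat) ^ b =
        ε ^ (ser r b (fun t => α (n + 1 - t)) p.1).toNat := by
      intro p
      by_cases h : p.1 = 0
      · simp only [ρ, h, dite_true, ser, hr, one_pow]
      · simp only [ρ, h, dite_false]
        rw [hfwd _ (by omega), show n + 1 - (n + 1 - p.1) = p.1 by omega]
    have hcρ' : ∀ p : Fin (n + 1),
        (ε ^ (ser r b (fun t => α (n + 1 - t)) (ρ p).1).toNat) ^ a =
          ε ^ (ser r a α p.1).toNat := by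
      intro p
      by_cases h : p.1 = 0
      · simp only [ρ, h, dite_true, ser, hr, one_pow]
      · simp only [ρ, h, dite_false]
        exact hbwd _ (by omega)
    refine nonempty_end_ringEquiv g g' (renameEquiv ℂ (Equiv.swap (0 : Fin 2) 1))
      swap_swap_apply inv inv' _ _ ρ hρ (fun p f hf => ?_) (fun p f hf => ?_)
    · rw [fwd hf, hcρ]
    · rw [bwd hf, hcρ']
end

section
/- Let 𝔪₀ ⊂ R be the maximal ideal consisting of all invariant polynomials with zero constant term. For every maximal ideal 𝔪 of R with 𝔪 ≠ 𝔪₀, the localization R_𝔪 ⊗_R Λ of Λ = End_R(T) at 𝔪 is isomorphic, as an R_𝔪-algebra, to the algebra of (n+1) × (n+1) matrices over the local ring R_𝔪. (Hence Λ is Azumaya over R away from 𝔪₀, i.e. the Azumaya locus of Λ is the complement of the singular point.) -/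
open MvPolynomial

open scoped TensorProduct

section EndomorphismBaseChange

variable {R A T E : Type*} [CommRing R] [CommRing A] [Algebra R A]
  [AddCommGroup T] [Module R T] [AddCommGroup E] [Module R E]

theorem tmul_smul_eq_mul_algebraMap_tmul (b : A) (t : R) (x : T) :
    b ⊗ₜ[R] (t • x) = (b * algebraMap R A t) ⊗ₜ[R] x := by
  rw [← TensorProduct.smul_tmul, Algebra.smul_def, mul_comm]

/-- If `φ : T → E` and `ψ : E → T` are mutually inverse up to multiplication by `s`, and `s` becomes
invertible in `A`, then conjugation identifies the base changes to `A` of the endomorphism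
algebras of `T` and `E`. -/
noncomputable def endBaseChangeAlgEquiv (s : R) (hs : IsUnit (algebraMap R A s))
    (φ : T →ₗ[R] E) (ψ : E →ₗ[R] T)
    (hφψ : ∀ x, φ (ψ x) = s • x) (hψφ : ∀ x, ψ (φ x) = s • x) :
    (A ⊗[R] Module.End R T) ≃ₐ[A] (A ⊗[R] Module.End R E) :=
  let F : Module.End R T →ₗ[R] Module.End R E :=
    LinearMap.lcomp R E ψ ∘ₗ LinearMap.llcomp R T T E φ
  let G : Module.End R E →ₗ[R] Module.End R T :=
    LinearMap.lcomp R T φ ∘ₗ LinearMap.llcomp R E E T ψ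
  have hunit : (↑hs.unit⁻¹ : A) * algebraMap R A s = 1 := hs.val_inv_mul
  have hcancel : (↑hs.unit⁻¹ * ↑hs.unit⁻¹ * algebraMap R A (s * s) : A) = 1 := by
    rw [map_mul, mul_mul_mul_comm, hunit, one_mul]
  have hFG (f) : F (G f) = (s * s) • f := by
    ext x
    simp [F, G, hφψ, mul_smul]
  have hGF (f) : G (F f) = (s * s) • f := by
    ext x
    simp [F, G, hψφ, mul_smul]
  have hmul (f h) : F f * F h = s • F (f * h) := by
    ext x
    simp [F, hψφ]
  have hone : F 1 = s • (1 : Module.End R E) := by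
    ext x
    simp [F, hφψ]
  Algebra.TensorProduct.algEquivOfLinearEquivTensorProduct
    (LinearEquiv.ofLinearMap
      ((↑hs.unit⁻¹ : A) • F.baseChange A) ((↑hs.unit⁻¹ : A) • G.baseChange A)
      (by
        ext f : 3
        simp only [← mul_assoc, TensorProduct.AlgebraTensorModule.curry_apply,
          TensorProduct.curry_apply, LinearMap.coe_restrictScalars, LinearMap.comp_apply, LinearMap.smul_apply,
          LinearMap.baseChange_tmul, hFG, tmul_smul_eq_mul_algebraMap_tmul,
          TensorProduct.smul_tmul', smul_eq_mul, mul_one, LinearMap.id_apply, hcancel])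
      (by
        ext f : 3
        simp only [← mul_assoc, TensorProduct.AlgebraTensorModule.curry_apply,
          TensorProduct.curry_apply, LinearMap.coe_restrictScalars, LinearMap.comp_apply, LinearMap.smul_apply,
          LinearMap.baseChange_tmul, hGF, tmul_smul_eq_mul_algebraMap_tmul,
          TensorProduct.smul_tmul', smul_eq_mul, mul_one, LinearMap.id_apply, hcancel]))
    (by
      intro b₁ b₂ f₁ f₂
      have hb : (↑hs.unit⁻¹ * b₁ * (↑hs.unit⁻¹ * b₂) * algebraMap R A s : A) =
          ↑hs.unit⁻¹ * (b₁ * b₂) := by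
        linear_combination (↑hs.unit⁻¹ * b₁ * b₂ : A) * hunit
      change (↑hs.unit⁻¹ : A) • ((b₁ * b₂) ⊗ₜ[R] F (f₁ * f₂)) =
        ((↑hs.unit⁻¹ : A) • (b₁ ⊗ₜ[R] F f₁)) * ((↑hs.unit⁻¹ : A) • (b₂ ⊗ₜ[R] F f₂))
      simp only [TensorProduct.smul_tmul', smul_eq_mul, Algebra.TensorProduct.tmul_mul_tmul, hmul,
        tmul_smul_eq_mul_algebraMap_tmul, hb])
    (by
      change (↑hs.unit⁻¹ : A) • ((1 : A) ⊗ₜ[R] F 1) = 1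
      rw [hone, tmul_smul_eq_mul_algebraMap_tmul, TensorProduct.smul_tmul', smul_eq_mul, one_mul,
        hunit, Algebra.TensorProduct.one_def])

theorem nonempty_baseChange_end_pi_algEquiv_matrix {ι : Type*} [Fintype ι] [DecidableEq ι]
    {M : ι → Type*} [∀ i, AddCommGroup (M i)] [∀ i, Module R (M i)]
    (s : R) (hs : IsUnit (algebraMap R A s))
    (h : ∀ i, ∃ (φ : M i →ₗ[R] R) (ψ : R →ₗ[R] M i),
      (∀ x, φ (ψ x) = s * x) ∧ ∀ x, ψ (φ x) = s • x) :
    Nonempty ((A ⊗[R] Module.End R (∀ i, M i)) ≃ₐ[A] Matrix ι ι A) := by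
  choose φ ψ hφψ hψφ using h
  refine ⟨((endBaseChangeAlgEquiv s hs
    (LinearMap.pi fun i => φ i ∘ₗ LinearMap.proj i)
    (LinearMap.pi fun i => ψ i ∘ₗ LinearMap.proj i) ?_ ?_).trans
      (Algebra.TensorProduct.congr AlgEquiv.refl LinearMap.toMatrixAlgEquiv')).trans ?_⟩
  · refine fun x => funext fun i => ?_
    exact hφψ i (x i)
  · refine fun x => funext fun i => ?_
    exact hψφ i (x i)
  · refine AlgEquiv.ofRingEquiv (f := (matrixEquivTensor ι R A).symm.toRingEquiv) fun b => ?_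
    change (matrixEquivTensor ι R A).symm (b ⊗ₜ 1) = _
    rw [matrixEquivTensor_apply_symm, Matrix.algebraMap_eq_diagonal]
    ext i j
    simp [Matrix.one_apply, Matrix.diagonal_apply]

end EndomorphismBaseChange

section Eigenspaces

variable {g : MvPolynomial (Fin 2) ℂ ≃ₐ[ℂ] MvPolynomial (Fin 2) ℂ}

theorem mem_fixedSub {p : MvPolynomial (Fin 2) ℂ} : p ∈ fixedSub g ↔ g p = p := Iff.rfl

theorem map_pow_of_map_eq_C_mul {z : MvPolynomial (Fin 2) ℂ} {ω : ℂ} (hz : g z = C ω * z)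
    (k : ℕ) : g (z ^ k) = C (ω ^ k) * z ^ k := by
  rw [map_pow, hz, mul_pow, C_pow]

theorem pow_mem_fixedSub {z : MvPolynomial (Fin 2) ℂ} {ω : ℂ} (hz : g z = C ω * z) {r : ℕ}
    (hω : ω ^ r = 1) : z ^ r ∈ fixedSub g := by
  rw [mem_fixedSub, map_pow_of_map_eq_C_mul hz, hω, C_1, one_mul]

set_option synthInstance.maxHeartbeats 1000000 in
set_option maxHeartbeats 8000000 in
/-- Elements `u`, `v` of inverse weights give maps between an eigenspace and the invariant ring
that are mutually inverse up to the invariant `u * v`. -/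
theorem exists_linearMap_eigenSub {c d : ℂ} (hcd : c * d = 1) {u v : MvPolynomial (Fin 2) ℂ}
    (hu : g u = C c * u) (hv : g v = C d * v) (s : fixedSub g)
    (hs : (s : MvPolynomial (Fin 2) ℂ) = u * v) :
    ∃ (φ : eigenSub g c →ₗ[fixedSub g] fixedSub g) (ψ : fixedSub g →ₗ[fixedSub g] eigenSub g c),
      (∀ x, φ (ψ x) = s * x) ∧ ∀ x, ψ (φ x) = s • x := by
  have hCC : (C c * C d : MvPolynomial (Fin 2) ℂ) = 1 := by rw [← C_mul, hcd, C_1]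
  let φ : eigenSub g c →ₗ[fixedSub g] fixedSub g :=
    { toFun := fun f => ⟨f.1 * v, by
        have hf : g f.1 = C c * f.1 := f.2
        rw [mem_fixedSub, map_mul, hf, hv, mul_mul_mul_comm, hCC, one_mul]⟩
      map_add' := fun f h => Subtype.ext (add_mul f.1 h.1 v)
      map_smul' := fun p f => Subtype.ext (mul_assoc p.1 f.1 v) }
  let ψ : fixedSub g →ₗ[fixedSub g] eigenSub g c :=
    { toFun := fun p => ⟨p.1 * u, by
        have hp : g p.1 = p.1 := p.2
        change g (p.1 * u) = C c * (p.1 * u)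
        rw [map_mul, hp, hu, mul_left_comm]⟩
      map_add' := fun f h => Subtype.ext (add_mul f.1 h.1 u)
      map_smul' := fun p f => Subtype.ext (mul_assoc p.1 f.1 u) }
  refine ⟨φ, ψ, ?_, ?_⟩
  · refine fun p => Subtype.ext ?_
    change p.1 * u * v = s.1 * p.1
    rw [hs]; ring
  · refine fun p => Subtype.ext ?_
    change p.1 * v * u = s.1 * p.1
    rw [hs]; ring

set_option synthInstance.maxHeartbeats 1000000 in
set_option maxHeartbeats 8000000 in
/-- Away from the zero locus of `z ^ r`, where `z` is a semi-invariant whose weight is a primitive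
`r`-th root of unity, the endomorphism ring of a sum of eigenspaces is a matrix ring. -/
theorem nonempty_baseChange_end_eigenSub_algEquiv_matrix {z : MvPolynomial (Fin 2) ℂ} {ω : ℂ}
    {r : ℕ} [NeZero r] (hz : g z = C ω * z) (hω : IsPrimitiveRoot ω r)
    {n : ℕ} (c : Fin (n + 1) → ℂ) (hc : ∀ i, c i ^ r = 1)
    {A : Type*} [CommRing A] [Algebra (fixedSub g) A]
    (hs : IsUnit (algebraMap (fixedSub g) A ⟨z ^ r, pow_mem_fixedSub hz hω.pow_eq_one⟩)) :
    Nonempty ((A ⊗[fixedSub g] Module.End (fixedSub g) ((i : Fin (n + 1)) → eigenSub g (c i)))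
      ≃ₐ[A] Matrix (Fin (n + 1)) (Fin (n + 1)) A) := by
  refine nonempty_baseChange_end_pi_algEquiv_matrix _ hs fun i => ?_
  obtain ⟨k, hk, hki⟩ := hω.eq_pow_of_pow_eq_one (hc i)
  rw [← hki]
  have hkr : k + (r - k) = r := Nat.add_sub_cancel' hk.le
  refine exists_linearMap_eigenSub (d := ω ^ (r - k)) ?_ (map_pow_of_map_eq_C_mul hz k)
    (map_pow_of_map_eq_C_mul hz (r - k)) _ ?_
  · rw [← pow_add, hkr, hω.pow_eq_one]
  · change z ^ r = _
    rw [← pow_add, hkr]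

theorem map_monomial_of_diagonal {ω₀ ω₁ : ℂ} (h₀ : g (X 0) = C ω₀ * X 0)
    (h₁ : g (X 1) = C ω₁ * X 1)
    (m : Fin 2 →₀ ℕ) (b : ℂ) :
    g (monomial m b) = monomial m (ω₀ ^ m 0 * ω₁ ^ m 1 * b) := by
  have hC : g (C b) = C b := g.commutes b
  rw [monomial_eq, monomial_eq, Finsupp.prod_fintype _ _ (by simp), Fin.prod_univ_two,
    map_mul, map_mul, hC, map_pow_of_map_eq_C_mul h₀, map_pow_of_map_eq_C_mul h₁, C_mul, C_mul]
  ring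

theorem coeff_map_of_diagonal {ω₀ ω₁ : ℂ} (h₀ : g (X 0) = C ω₀ * X 0)
    (h₁ : g (X 1) = C ω₁ * X 1)
    (p : MvPolynomial (Fin 2) ℂ) (m : Fin 2 →₀ ℕ) :
    coeff m (g p) = ω₀ ^ m 0 * ω₁ ^ m 1 * coeff m p := by
  induction p using MvPolynomial.induction_on' with
  | monomial k b =>
    rw [map_monomial_of_diagonal h₀ h₁, coeff_monomial, coeff_monomial]
    split_ifs with h
    · rw [h]
    · rw [mul_zero]
  | add p q hp hq => rw [map_add, coeff_add, coeff_add, hp, hq, mul_add]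

theorem monomial_coeff_mem_fixedSub {ω₀ ω₁ : ℂ} (h₀ : g (X 0) = C ω₀ * X 0)
    (h₁ : g (X 1) = C ω₁ * X 1)
    {p : MvPolynomial (Fin 2) ℂ} (hp : p ∈ fixedSub g)
    (m : Fin 2 →₀ ℕ) : monomial m (coeff m p) ∈ fixedSub g := by
  rw [mem_fixedSub, map_monomial_of_diagonal h₀ h₁, ← coeff_map_of_diagonal h₀ h₁,
    mem_fixedSub.1 hp]

theorem ker_constantCoeff_le {ω₀ ω₁ : ℂ} (h₀ : g (X 0) = C ω₀ * X 0)
    (h₁ : g (X 1) = C ω₁ * X 1)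
    {r : ℕ} (hω₀ : ω₀ ^ r = 1) (hω₁ : ω₁ ^ r = 1)
    (𝔪 : Ideal (fixedSub g)) [𝔪.IsPrime]
    (hx : (⟨X 0 ^ r, pow_mem_fixedSub h₀ hω₀⟩ : fixedSub g) ∈ 𝔪)
    (hy : (⟨X 1 ^ r, pow_mem_fixedSub h₁ hω₁⟩ : fixedSub g) ∈ 𝔪) :
    RingHom.ker (MvPolynomial.constantCoeff.comp (fixedSub g).val.toRingHom) ≤ 𝔪 := by
  intro p hp
  have hp0 : coeff 0 p.1 = 0 := hp
  have hsum : p = ∑ m ∈ p.1.support,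
      (⟨monomial m (coeff m p.1), monomial_coeff_mem_fixedSub h₀ h₁ p.2 m⟩ : fixedSub g) := by
    apply Subtype.ext
    rw [AddSubmonoidClass.coe_finsetSum]
    exact p.1.as_sum
  rw [hsum]
  refine Ideal.sum_mem _ fun m hm => ?_
  refine Ideal.IsPrime.mem_of_pow_mem ‹_› r ?_
  have key : (⟨monomial m (coeff m p.1), monomial_coeff_mem_fixedSub h₀ h₁ p.2 m⟩ : fixedSub g) ^ r
      = algebraMap ℂ (fixedSub g) (coeff m p.1 ^ r) *
        ((⟨X 0 ^ r, pow_mem_fixedSub h₀ hω₀⟩ : fixedSub g) ^ m 0 *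
          (⟨X 1 ^ r, pow_mem_fixedSub h₁ hω₁⟩ : fixedSub g) ^ m 1) := by
    apply Subtype.ext
    change (monomial m (coeff m p.1)) ^ r =
      C (coeff m p.1 ^ r) * ((X 0 ^ r) ^ m 0 * (X 1 ^ r) ^ m 1)
    rw [monomial_eq, Finsupp.prod_fintype _ _ (by simp), Fin.prod_univ_two, C_pow]
    ring
  rw [key]
  refine Ideal.mul_mem_left _ _ ?_
  by_cases hm0 : m 0 = 0
  · have hm1 : m 1 ≠ 0 := by
      intro hm1
      have : m = 0 := by
        ext i
        fin_cases i
        · exact hm0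
        · exact hm1
      rw [this] at hm
      exact (mem_support_iff.1 hm) hp0
    exact Ideal.mul_mem_left _ _ (Ideal.pow_mem_of_mem _ hy _ (Nat.pos_of_ne_zero hm1))
  · exact Ideal.mul_mem_right _ _ (Ideal.pow_mem_of_mem _ hx _ (Nat.pos_of_ne_zero hm0))

theorem eq_ker_constantCoeff {ω₀ ω₁ : ℂ} (h₀ : g (X 0) = C ω₀ * X 0)
    (h₁ : g (X 1) = C ω₁ * X 1)
    {r : ℕ} (hω₀ : ω₀ ^ r = 1) (hω₁ : ω₁ ^ r = 1)
    (𝔪 : Ideal (fixedSub g)) [𝔪.IsPrime]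
    (hx : (⟨X 0 ^ r, pow_mem_fixedSub h₀ hω₀⟩ : fixedSub g) ∈ 𝔪)
    (hy : (⟨X 1 ^ r, pow_mem_fixedSub h₁ hω₁⟩ : fixedSub g) ∈ 𝔪) :
    𝔪 = RingHom.ker (MvPolynomial.constantCoeff.comp (fixedSub g).val.toRingHom) := by
  have hsurj : Function.Surjective
      (MvPolynomial.constantCoeff.comp (fixedSub g).val.toRingHom) := fun b =>
    ⟨algebraMap ℂ (fixedSub g) b, constantCoeff_C (Fin 2) b⟩
  have hmax := RingHom.ker_isMaximal_of_surjective _ hsurj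
  exact (hmax.eq_of_le Ideal.IsPrime.ne_top' (ker_constantCoeff_le h₀ h₁ hω₀ hω₁ 𝔪 hx hy)).symm

end Eigenspaces

set_option synthInstance.maxHeartbeats 1000000 in
set_option maxHeartbeats 8000000 in
/-- away from the maximal ideal `𝔪₀` of the singular point (the invariant
polynomials with zero constant term), the localization of `Λ = End_R(T)` is the full
`(n+1) × (n+1)` matrix algebra over the local ring `R_𝔪`; i.e. the Azumaya locus of `Λ`
is the complement of the singular point. -/
theorem stmt_17 (r a n : ℕ) (α : ℕ → ℕ)
    (ha : 1 ≤ a) (har : a < r) (hcop : Nat.Coprime r a) (hn : 1 ≤ n)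
    (hα : ∀ t, 1 ≤ t → t ≤ n → 2 ≤ α t)
    (hval : hj ((List.range n).map fun t => (α (t + 1) : ℚ)) = (r : ℚ) / (a : ℚ))
    (ε : ℂ) (hε : IsPrimitiveRoot ε r)
    (g : MvPolynomial (Fin 2) ℂ ≃ₐ[ℂ] MvPolynomial (Fin 2) ℂ)
    (hgx : g (X 0) = C ε * X 0) (hgy : g (X 1) = C (ε ^ a) * X 1) :
    ∀ (𝔪 : Ideal (fixedSub g)) [𝔪.IsMaximal],
      𝔪 ≠ RingHom.ker (MvPolynomial.constantCoeff.comp (fixedSub g).val.toRingHom) →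
      Nonempty
        ((Localization.AtPrime 𝔪 ⊗[fixedSub g]
            (Module.End (fixedSub g)
              ((p : Fin (n + 1)) → eigenSub g (ε ^ (ser r a α p.1).toNat)))) ≃ₐ[Localization.AtPrime 𝔪]
          Matrix (Fin (n + 1)) (Fin (n + 1)) (Localization.AtPrime 𝔪)) := by
  intro 𝔪 _ h𝔪
  have : NeZero r := ⟨by omega⟩
  have hεa : IsPrimitiveRoot (ε ^ a) r := hε.pow_of_coprime a hcop.symm
  have hc (i : Fin (n + 1)) : (ε ^ (ser r a α i.1).toNat) ^ r = 1 := by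
    rw [← pow_mul, mul_comm, pow_mul, hε.pow_eq_one, one_pow]
  by_cases hx : (⟨X 0 ^ r, pow_mem_fixedSub hgx hε.pow_eq_one⟩ : fixedSub g) ∈ 𝔪
  · by_cases hy : (⟨X 1 ^ r, pow_mem_fixedSub hgy hεa.pow_eq_one⟩ : fixedSub g) ∈ 𝔪
    · exact absurd (eq_ker_constantCoeff hgx hgy hε.pow_eq_one hεa.pow_eq_one 𝔪 hx hy) h𝔪
    · exact nonempty_baseChange_end_eigenSub_algEquiv_matrix hgy hεa _ hc
        (IsLocalization.map_units (Localization.AtPrime 𝔪) (⟨_, hy⟩ : 𝔪.primeCompl))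
  · exact nonempty_baseChange_end_eigenSub_algEquiv_matrix hgx hε _ hc
      (IsLocalization.map_units (Localization.AtPrime 𝔪) (⟨_, hx⟩ : 𝔪.primeCompl))
end
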